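/- Let W be a Weyl group, s ∈ S, and y, w involutions with y ≤ w (Bruhat order) and sw < w. If sy = ys then sy ≤ w; if sy ≠ ys then sys ≤ w. -/

import Mathlib

/-- Bruhat order on a Coxeter group: `y ≤ w` iff some reduced word for `w`
has a sublist whose product is `y`. -/
def CoxeterSystem.BruhatLE {B W : Type*} [Group W] {M : CoxeterMatrix B}
    (cs : CoxeterSystem M W) (y w : W) : Prop :=
  ∃ ω : List B, cs.IsReduced ω ∧ cs.wordProd ω = w ∧
    ∃ ω' : List B, ω'.Sublist ω ∧ cs.wordProd ω' = y

open Classical in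
/-- The involution `(t, e) ↦ (s t s, e + [t = s])` of `W × ℤ/2` attached to a simple
reflection `s`. -/
noncomputable def CoxeterSystem.signedConj {B W : Type*} [Group W] {M : CoxeterMatrix B}
    (cs : CoxeterSystem M W) (i : B) : Equiv.Perm (W × ZMod 2) :=
  Function.Involutive.toPerm
    (fun p => (cs.simple i * p.1 * cs.simple i, p.2 + if p.1 = cs.simple i then 1 else 0)) (by
      rintro ⟨t, e⟩
      have h : cs.simple i * t * cs.simple i = cs.simple i ↔ t = cs.simple i := by
        constructor
        · intro h
          have := congrArg (fun x => cs.simple i * x * cs.simple i) h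
          simpa [mul_assoc] using this
        · rintro rfl
          simp
      by_cases ht : t = cs.simple i
      · simp [ht, add_assoc, CharTwo.add_self_eq_zero]
      · simp only [h, ht, if_false, add_zero]
        simp [mul_assoc])

namespace CoxeterSystem

variable {B W : Type*} [Group W] {M : CoxeterMatrix B} (cs : CoxeterSystem M W)

open Classical in
theorem signedConj_apply (i : B) (t : W) (e : ZMod 2) :
    cs.signedConj i (t, e) =
      (cs.simple i * t * cs.simple i, e + if t = cs.simple i then 1 else 0) := rfl

open Classical in
theorem signedConj_mul_pow_apply (i j : B) (k : ℕ) (t : W) (e : ZMod 2) :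
    ((cs.signedConj i * cs.signedConj j) ^ k) (t, e) =
      ((cs.simple i * cs.simple j) ^ k * t * ((cs.simple i * cs.simple j) ^ k)⁻¹,
        e + ∑ n ∈ Finset.range (2 * k),
          if t = ((cs.simple i * cs.simple j) ^ n)⁻¹ * cs.simple j then 1 else 0) := by
  induction k with
  | zero => simp
  | succ k ih =>
    set r := cs.simple i * cs.simple j with hr
    have hsemi : SemiconjBy (cs.simple j) (r ^ k) (r⁻¹ ^ k) := by
      apply SemiconjBy.pow_right
      simp [SemiconjBy, hr, mul_assoc]
    have hs : cs.simple j * r ^ k = (r ^ k)⁻¹ * cs.simple j := by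
      rw [← inv_pow]; exact hsemi
    have hconj : ∀ u : W, r ^ k * t * (r ^ k)⁻¹ = u ↔ t = (r ^ k)⁻¹ * u * r ^ k := by
      intro u
      constructor
      · rintro rfl; group
      · rintro h; rw [h]; group
    have h₁ : r ^ k * t * (r ^ k)⁻¹ = cs.simple j ↔ t = (r ^ (2 * k))⁻¹ * cs.simple j := by
      rw [hconj, mul_assoc, hs, two_mul, pow_add, mul_inv_rev, mul_assoc]
    have h₂ : cs.simple j * (r ^ k * t * (r ^ k)⁻¹) * cs.simple j = cs.simple i ↔
        t = (r ^ (2 * k + 1))⁻¹ * cs.simple j := by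
      have hsr : cs.simple j * cs.simple i * cs.simple j = r⁻¹ * cs.simple j := by
        simp [hr, mul_assoc]
      have e₁ : cs.simple j * (r ^ k * t * (r ^ k)⁻¹) * cs.simple j = cs.simple i ↔
          r ^ k * t * (r ^ k)⁻¹ = r⁻¹ * cs.simple j := by
        rw [← hsr]
        constructor
        · intro h; rw [← h]; simp [mul_assoc]
        · intro h; rw [h]; simp [mul_assoc]
      rw [e₁, hconj, mul_assoc, mul_assoc, hs, show 2 * k + 1 = k + 1 + k by ring, pow_add,
        pow_succ']
      simp only [mul_inv_rev, mul_assoc]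
      rw [← mul_assoc r⁻¹, ← mul_assoc (r ^ k)⁻¹ r⁻¹]
      rw [← mul_inv_rev, ← mul_inv_rev, ← pow_succ, ← pow_succ']
    rw [pow_succ', Equiv.Perm.mul_apply, ih, Equiv.Perm.mul_apply, signedConj_apply,
      signedConj_apply]
    simp only [h₁, h₂]
    rw [show 2 * (k + 1) = 2 * k + 1 + 1 by ring, Finset.sum_range_succ, Finset.sum_range_succ]
    refine Prod.ext ?_ ?_
    · simp [pow_succ', hr, mul_assoc]
    · simp only [add_assoc]

theorem isLiftable_signedConj : M.IsLiftable cs.signedConj := by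
  intro i j
  have hm := cs.simple_mul_simple_pow i j
  generalize M.M i j = m at hm ⊢
  ext1 ⟨t, e⟩
  rw [signedConj_mul_pow_apply, hm, two_mul, Finset.sum_range_add, ← Finset.sum_add_distrib]
  rw [Finset.sum_eq_zero fun n _ => ?_]
  · simp
  · rw [pow_add, hm, one_mul, CharTwo.add_self_eq_zero]

/-- The action of `W` on `W × ℤ/2` extending `signedConj`. -/
noncomputable def signedConjHom : W →* Equiv.Perm (W × ZMod 2) :=
  cs.lift ⟨cs.signedConj, cs.isLiftable_signedConj⟩

theorem signedConjHom_simple (i : B) : cs.signedConjHom (cs.simple i) = cs.signedConj i :=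
  cs.lift_apply_simple cs.isLiftable_signedConj i

open Classical in
theorem signedConjHom_wordProd_apply (ω : List B) (t : W) (e : ZMod 2) :
    cs.signedConjHom (cs.wordProd ω) (t, e) =
      (cs.wordProd ω * t * (cs.wordProd ω)⁻¹, e + ((cs.rightInvSeq ω).count t : ZMod 2)) := by
  induction ω with
  | nil => simp
  | cons i ω ih =>
    have h : cs.wordProd ω * t * (cs.wordProd ω)⁻¹ = cs.simple i ↔
        (cs.wordProd ω)⁻¹ * cs.simple i * cs.wordProd ω = t := by
      constructor
      · intro h; rw [← h]; group
      · rintro rfl; group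
    rw [wordProd_cons, map_mul, Equiv.Perm.mul_apply, ih, signedConjHom_simple,
      signedConj_apply, rightInvSeq, List.count_cons]
    simp only [h, beq_iff_eq]
    simp [mul_assoc, add_assoc]

theorem signedConjHom_apply_snd (w t : W) (e : ZMod 2) :
    cs.signedConjHom w (t, e) =
      (w * t * w⁻¹, e + (cs.signedConjHom w (t, 0)).2) := by
  obtain ⟨ω, rfl⟩ := cs.wordProd_surjective w
  simp [signedConjHom_wordProd_apply]

theorem IsReflection.signedConjHom_apply_self {cs : CoxeterSystem M W} {t : W}
    (ht : cs.IsReflection t) (e : ZMod 2) : cs.signedConjHom t (t, e) = (t, e + 1) := by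
  obtain ⟨u, i, rfl⟩ := ht
  set t := u * cs.simple i * u⁻¹ with htdef
  have hinv : cs.signedConjHom u (cs.signedConjHom u⁻¹ (t, e)) = (t, e) := by
    rw [← Equiv.Perm.mul_apply, ← map_mul]
    simp
  have hfst : u⁻¹ * t * u⁻¹⁻¹ = cs.simple i := by rw [htdef]; group
  rw [cs.signedConjHom_apply_snd u⁻¹, hfst] at hinv
  have key : cs.signedConjHom t (t, e) =
      cs.signedConjHom u (cs.signedConjHom (cs.simple i) (cs.signedConjHom u⁻¹ (t, e))) := by
    rw [← Equiv.Perm.mul_apply, ← Equiv.Perm.mul_apply, ← map_mul, ← map_mul]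
  rw [key, cs.signedConjHom_apply_snd u⁻¹, hfst, signedConjHom_simple, signedConj_apply]
  rw [cs.signedConjHom_apply_snd u] at hinv ⊢
  have h2 := congrArg Prod.snd hinv
  refine Prod.ext ?_ ?_
  · simp [htdef]
  · simp only [simple_mul_simple_self, one_mul, if_true] at h2 ⊢
    rw [add_right_comm, h2]

/-- The strong exchange property. -/
theorem mem_rightInvSeq_of_isRightInversion {ω : List B} {t : W}
    (h : cs.IsRightInversion (cs.wordProd ω) t) : t ∈ cs.rightInvSeq ω := by
  classical
  obtain ⟨ht, hlt⟩ := h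
  by_contra hmem
  obtain ⟨ρ, hρ, hρw⟩ := cs.exists_isReduced (cs.wordProd ω * t)
  have h₁ : cs.signedConjHom (cs.wordProd ρ) (t, 0) =
      (cs.wordProd ω * t * (cs.wordProd ω)⁻¹, 1) := by
    rw [← hρw, map_mul, Equiv.Perm.mul_apply, ht.signedConjHom_apply_self,
      signedConjHom_wordProd_apply, List.count_eq_zero_of_not_mem hmem]
    simp
  rw [signedConjHom_wordProd_apply] at h₁
  have hmem' : t ∈ cs.rightInvSeq ρ := by
    by_contra hn
    rw [List.count_eq_zero_of_not_mem hn] at h₁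
    simpa using congrArg Prod.snd h₁
  have := (cs.isRightInversion_of_mem_rightInvSeq hρ hmem').2
  rw [← hρw, mul_assoc, ht.mul_self, mul_one] at this
  omega

theorem exists_eraseIdx_of_isRightInversion {ω : List B} {t : W}
    (h : cs.IsRightInversion (cs.wordProd ω) t) :
    ∃ j < ω.length, cs.wordProd ω * t = cs.wordProd (ω.eraseIdx j) := by
  obtain ⟨j, hj, rfl⟩ := List.mem_iff_getElem.mp (cs.mem_rightInvSeq_of_isRightInversion h)
  refine ⟨j, by simpa using hj, ?_⟩
  rw [← wordProd_mul_getD_rightInvSeq, List.getD_eq_getElem _ _ hj]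

/-- `x` is obtained from `w` by multiplying by a reflection that shortens `w`. -/
def BruhatStep (w x : W) : Prop := ∃ t, cs.IsRightInversion w t ∧ x = w * t

theorem bruhatStep_simple_mul {w : W} {i : B}
    (h : cs.length (cs.simple i * w) < cs.length w) : cs.BruhatStep w (cs.simple i * w) := by
  have e : cs.simple i * w = w * (w⁻¹ * cs.simple i * w) := by group
  refine ⟨w⁻¹ * cs.simple i * w, ⟨⟨w⁻¹, i, by simp⟩, ?_⟩, e⟩
  rwa [← e]

theorem BruhatStep.simple_mul {cs : CoxeterSystem M W} {w x : W} (h : cs.BruhatStep w x)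
    (i : B) :
    cs.BruhatStep (cs.simple i * w) (cs.simple i * x) ∨ cs.simple i * x = w := by
  obtain ⟨t, ht, rfl⟩ := h
  by_cases hlt : cs.length (cs.simple i * w * t) < cs.length (cs.simple i * w)
  · exact Or.inl ⟨t, ⟨ht.1, hlt⟩, (mul_assoc _ _ _).symm⟩
  right
  have hwt := ht.2
  obtain ⟨α, hα, hαw⟩ := cs.exists_isReduced (cs.simple i * w)
  have hαl := hα.eq
  rw [← hαw] at hαl
  have hw : w = cs.wordProd (i :: α) := by rw [wordProd_cons, ← hαw]; simp
  have hsw := cs.length_simple_mul w i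
  have hswt := cs.length_simple_mul (w * t) i
  rw [← mul_assoc] at hswt
  obtain ⟨j, hj, hjw⟩ := cs.exists_eraseIdx_of_isRightInversion (hw ▸ ht)
  rw [← hw] at hjw
  cases j with
  | zero =>
    rw [hjw, List.eraseIdx_cons_zero, ← hαw]
    simp
  | succ j =>
    rw [List.eraseIdx_cons_succ, wordProd_cons] at hjw
    have hlen := cs.length_wordProd_le (α.eraseIdx j)
    have hj' : j < α.length := by simpa using hj
    rw [List.length_eraseIdx_of_lt hj'] at hlen
    have e : cs.simple i * w * t = cs.wordProd (α.eraseIdx j) := by rw [mul_assoc, hjw]; simp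
    rw [← e] at hlen
    omega

theorem simple_mul_of_reflTransGen_bruhatStep {w x : W}
    (h : Relation.ReflTransGen cs.BruhatStep w x) (i : B) :
    Relation.ReflTransGen cs.BruhatStep (cs.simple i * w) (cs.simple i * x) ∨
      Relation.ReflTransGen cs.BruhatStep w (cs.simple i * x) := by
  induction h with
  | refl => exact Or.inl .refl
  | tail hwb hbc ih =>
    rcases hbc.simple_mul i with hstep | heq
    · exact ih.imp (·.tail hstep) (·.tail hstep)
    · exact Or.inr (heq ▸ hwb)

theorem reflTransGen_bruhatStep_of_sublist {ω σ : List B} (hω : cs.IsReduced ω)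
    (h : σ.Sublist ω) :
    Relation.ReflTransGen cs.BruhatStep (cs.wordProd ω) (cs.wordProd σ) := by
  induction h with
  | slnil => exact .refl
  | @cons σ ω i h ih =>
    have hred : cs.IsReduced ω := by simpa using hω.drop 1
    have hlt : cs.length (cs.simple i * cs.wordProd (i :: ω)) <
        cs.length (cs.wordProd (i :: ω)) := by
      rw [hω.eq, wordProd_cons, simple_mul_simple_cancel_left, hred.eq]
      simp
    have hstep := cs.bruhatStep_simple_mul hlt
    rw [wordProd_cons, simple_mul_simple_cancel_left, ← wordProd_cons] at hstep
    exact .head hstep (ih hred)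
  | @cons_cons σ ω i h ih =>
    have hred : cs.IsReduced ω := by simpa using hω.drop 1
    have hlt : cs.length (cs.simple i * cs.wordProd (i :: ω)) <
        cs.length (cs.wordProd (i :: ω)) := by
      rw [hω.eq, wordProd_cons, simple_mul_simple_cancel_left, hred.eq]
      simp
    have hstep := cs.bruhatStep_simple_mul hlt
    rw [wordProd_cons, simple_mul_simple_cancel_left, ← wordProd_cons] at hstep
    rw [wordProd_cons _ i σ]
    rcases cs.simple_mul_of_reflTransGen_bruhatStep (ih hred) i with h' | h'
    · rwa [wordProd_cons]
    · exact .head hstep h'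

theorem exists_sublist_of_reflTransGen_bruhatStep {ω : List B} {x : W}
    (h : Relation.ReflTransGen cs.BruhatStep (cs.wordProd ω) x) :
    ∃ σ : List B, σ.Sublist ω ∧ cs.wordProd σ = x := by
  induction h with
  | refl => exact ⟨ω, List.Sublist.refl _, rfl⟩
  | tail _ hbc ih =>
    obtain ⟨σ, hσ, rfl⟩ := ih
    obtain ⟨t, ht, rfl⟩ := hbc
    obtain ⟨j, -, hj⟩ := cs.exists_eraseIdx_of_isRightInversion ht
    exact ⟨σ.eraseIdx j, (List.eraseIdx_sublist _ _).trans hσ, hj.symm⟩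

variable {cs}

/-- The subword property: every reduced word of `w` has a subword with product `y`. -/
theorem BruhatLE.exists_sublist {y : W} {ω : List B} (h : cs.BruhatLE y (cs.wordProd ω)) :
    ∃ σ : List B, σ.Sublist ω ∧ cs.wordProd σ = y := by
  obtain ⟨ρ, hρ, hρw, σ, hσ, rfl⟩ := h
  exact cs.exists_sublist_of_reflTransGen_bruhatStep
    (hρw ▸ cs.reflTransGen_bruhatStep_of_sublist hρ hσ)

theorem BruhatLE.inv {y w : W} (h : cs.BruhatLE y w) : cs.BruhatLE y⁻¹ w⁻¹ := by
  obtain ⟨ω, hω, rfl, σ, hσ, rfl⟩ := h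
  exact ⟨ω.reverse, hω.reverse, cs.wordProd_reverse ω, σ.reverse, hσ.reverse,
    cs.wordProd_reverse σ⟩

theorem BruhatLE.simple_mul {y w : W} {i : B} (h : cs.BruhatLE y w)
    (hw : cs.length (cs.simple i * w) < cs.length w) : cs.BruhatLE (cs.simple i * y) w := by
  obtain ⟨α, hα, hαw⟩ := cs.exists_isReduced (cs.simple i * w)
  have hwα : cs.wordProd (i :: α) = w := by rw [wordProd_cons, ← hαw]; simp
  have hred : cs.IsReduced (i :: α) := by
    have hl := hα.eq
    rw [← hαw] at hl
    rw [IsReduced, hwα, List.length_cons]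
    have := cs.length_simple_mul w i
    omega
  obtain ⟨σ, hσ, rfl⟩ := (hwα ▸ h).exists_sublist
  refine ⟨i :: α, hred, hwα, ?_⟩
  cases hσ with
  | cons _ hσ => exact ⟨i :: σ, hσ.cons_cons i, wordProd_cons _ _ _⟩
  | cons_cons _ hσ => exact ⟨_, hσ.cons i, by simp [wordProd_cons]⟩

end CoxeterSystem

/-- let `y ≤ w` be involutions in a Weyl group and `s` a simple reflection
with `sw < w`. If `sy = ys` then `sy ≤ w`; if `sy ≠ ys` then `sys ≤ w`. -/
theorem involution_bruhat_lifting {B W : Type*} [Group W] [Finite W] {M : CoxeterMatrix B}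
    (cs : CoxeterSystem M W) (i : B) (y w : W)
    (hy : y * y = 1) (hw : w * w = 1)
    (hyw : cs.BruhatLE y w)
    (hsw : cs.length (cs.simple i * w) < cs.length w) :
    (cs.simple i * y = y * cs.simple i → cs.BruhatLE (cs.simple i * y) w) ∧
    (cs.simple i * y ≠ y * cs.simple i → cs.BruhatLE (cs.simple i * y * cs.simple i) w) := by
  have hsy := hyw.simple_mul hsw
  refine ⟨fun _ => hsy, fun _ => ?_⟩
  have hy' : y⁻¹ = y := inv_eq_of_mul_eq_one_left hy
  have hw' : w⁻¹ = w := inv_eq_of_mul_eq_one_left hw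
  have h := hsy.inv
  rw [hw'] at h
  simpa [hw', hy', mul_assoc] using (h.simple_mul hsw).inv
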